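/- arXiv:2303.00743 — 2 statements merged into one kernel-verified Lean document; each statement's English description precedes it below -/
import Mathlib

section
/- Let θ, z(k) and F_k be as in the context, and let k ∈ ℂ. Then F_k is smooth on ℂ ∖ Λ (as a function of the real coordinates x, y with z = x + iy), and for every z ∉ Λ it satisfies (2D_z̄ + k)F_k(z) = 0, i.e. −i(∂_x F_k(z) + i∂_y F_k(z)) + k·F_k(z) = 0. -/
noncomputable section

open Complex ComplexConjugate

/-- ω = exp(2πi/3). -/
def ω : ℂ := Complex.exp (2 * Real.pi * Complex.I / 3)

/-- The lattice Λ = ℤ + ωℤ. -/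
def Lam : Set ℂ := {z : ℂ | ∃ m n : ℤ, z = (m : ℂ) + (n : ℂ) * ω}

/-- The dual lattice Λ* = (4πi/√3)Λ. -/
def LamS : Set ℂ :=
  {z : ℂ | ∃ m n : ℤ,
    z = 4 * (Real.pi : ℂ) * Complex.I / (Real.sqrt 3 : ℂ) * ((m : ℂ) + (n : ℂ) * ω)}

/-- ⟨z,w⟩ = Re (z ⬝ conj w). -/
def pairing (z w : ℂ) : ℝ := (z * conj w).re

/-- K = 4π/3. -/
def Kpt : ℂ := 4 * (Real.pi : ℂ) / 3

/-- 2D_z̄ u = −i(∂ₓu + i∂9u), via the real Fréchet derivative. -/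
def twoDbar (u : ℂ → ℂ) (z : ℂ) : ℂ :=
  -Complex.I * (fderiv ℝ u z 1 + Complex.I * fderiv ℝ u z Complex.I)

/-- The magnetic chiral Dirac operator D_B(α). -/
def DB (U : ℂ → ℂ) (α B : ℂ) (u : ℂ → ℂ × ℂ) (z : ℂ) : ℂ × ℂ :=
  (twoDbar (fun w => (u w).1) z + α * U z * (u z).2 + B * (u z).1,
   α * U (-z) * (u z).1 + twoDbar (fun w => (u w).2) z - B * (u z).2)

/-- The chiral Dirac operator D(α) (no magnetic field). -/
def Dop (U : ℂ → ℂ) (α : ℂ) (u : ℂ → ℂ × ℂ) (z : ℂ) : ℂ × ℂ :=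
  (twoDbar (fun w => (u w).1) z + α * U z * (u z).2,
   α * U (-z) * (u z).1 + twoDbar (fun w => (u w).2) z)

/-- The L²₀ boundary condition. -/
def BC (u : ℂ → ℂ × ℂ) : Prop :=
  ∀ γ ∈ Lam, ∀ z : ℂ,
    u (z + γ) = (Complex.exp (-Complex.I * (pairing γ Kpt : ℂ)) * (u z).1,
                 Complex.exp (Complex.I * (pairing γ Kpt : ℂ)) * (u z).2)

/-- Hypotheses on the potential U. -/
def IsPotential (U : ℂ → ℂ) : Prop :=
  ContDiff ℝ (⊤ : ℕ∞) U ∧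
  (∀ γ ∈ Lam, ∀ z : ℂ,
    U (z + γ) = Complex.exp (-2 * Complex.I * (pairing γ Kpt : ℂ)) * U z) ∧
  (∀ z : ℂ, U (ω * z) = ω * U z) ∧
  (∀ z : ℂ, conj (U (conj z)) = - U (-z))

/-- The Jacobi theta function θ(z) = θ₁(z|ω) = −θ_{1/2,1/2}(z|ω). -/
def θf (z : ℂ) : ℂ :=
  -∑' n : ℤ, Complex.exp ((Real.pi : ℂ) * Complex.I * ((n : ℂ) + 1/2)^2 * ω
      + 2 * (Real.pi : ℂ) * Complex.I * ((n : ℂ) + 1/2) * (z + 1/2))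

/-- z(k) = √3 k / (4πi). -/
def zpt (k : ℂ) : ℂ := (Real.sqrt 3 : ℂ) * k / (4 * (Real.pi : ℂ) * Complex.I)

/-- F_k(z) = e^{(i/2)(z − z̄)k} θ(z − z(k)) / θ(z). -/
def Fk (k z : ℂ) : ℂ :=
  Complex.exp (Complex.I / 2 * (z - conj z) * k) * θf (z - zpt k) / θf z

lemma omega_eq : ω = -1/2 + (Real.sqrt 3 / 2 : ℝ) * I := by
  have h : (2 * Real.pi * Complex.I / 3 : ℂ) = ((Real.pi - Real.pi / 3 : ℝ) : ℂ) * I := by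
    push_cast; ring
  rw [ω, h, Complex.exp_mul_I, ← Complex.ofReal_cos, ← Complex.ofReal_sin, Real.cos_pi_sub,
    Real.sin_pi_sub, Real.cos_pi_div_three, Real.sin_pi_div_three]
  push_cast; ring

lemma omega_im : ω.im = Real.sqrt 3 / 2 := by
  rw [omega_eq]; simp

lemma omega_im_pos : 0 < ω.im := by
  rw [omega_im]; positivity

lemma theta_eq (z : ℂ) : θf z =
    -(cexp (Real.pi * I * ω / 4 + Real.pi * I * (z + 1/2)) *
      jacobiTheta₂ (z + 1/2 + ω / 2) ω) := by
  rw [θf, jacobiTheta₂, ← tsum_mul_left]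
  congr 1
  refine tsum_congr fun n => ?_
  rw [jacobiTheta₂_term, ← Complex.exp_add]
  congr 1
  ring

lemma theta_differentiable : Differentiable ℂ θf := by
  have h : θf = fun z => -(cexp (Real.pi * I * ω / 4 + Real.pi * I * (z + 1/2)) *
      jacobiTheta₂ (z + 1/2 + ω / 2) ω) := funext theta_eq
  rw [h]
  intro z
  have h1 : DifferentiableAt ℂ (fun z : ℂ => jacobiTheta₂ (z + 1/2 + ω / 2) ω) z :=
    DifferentiableAt.comp (g := fun v => jacobiTheta₂ v ω) z
      (differentiableAt_jacobiTheta₂_fst _ omega_im_pos) (by fun_prop)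
  fun_prop

lemma theta_add_omega (z : ℂ) : θf (z + ω) = 0 ↔ θf z = 0 := by
  rw [theta_eq, theta_eq]
  have h : z + ω + 1/2 + ω / 2 = (z + 1/2 + ω/2) + ω := by ring
  rw [h, jacobiTheta₂_add_left']
  simp [Complex.exp_ne_zero]

lemma theta_add_int_omega (n : ℤ) (z : ℂ) : θf (z + n * ω) = 0 ↔ θf z = 0 := by
  induction n with
  | zero => simp
  | succ k ih =>
    rw [← ih, ← theta_add_omega (z + ((k : ℤ) : ℂ) * ω)]
    push_cast; ring_nf
  | pred k ih =>
    rw [← ih, ← theta_add_omega (z + _)]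
    push_cast; ring_nf

lemma d_bound (x : ℂ) (hx : x ≠ 0) (R : ℝ) (hR : 1 ≤ R) (h1 : ‖x‖ ≤ R) (h2 : ‖x⁻¹‖ ≤ R) (n : ℕ) :
    ‖x ^ n - x⁻¹ ^ (n+1)‖ ≤ ‖1 - x⁻¹‖ * (3 * R) ^ n := by
  induction n with
  | zero => simp
  | succ n ih =>
    have e : x ^ (n+1) - x⁻¹ ^ (n+1+1) =
        (x ^ n - x⁻¹ ^ (n+1)) + (1 - x⁻¹) * (x ^ (n+1) + x⁻¹ ^ (n+1)) := by
      have : x⁻¹ * x = 1 := inv_mul_cancel₀ hx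
      have h3 : x⁻¹ * x ^ (n+1) = x ^ n := by
        rw [pow_succ', ← mul_assoc, this, one_mul]
      linear_combination h3
    have hb1 : ‖x ^ (n+1)‖ ≤ R ^ (n+1) := by rw [norm_pow]; gcongr
    have hb2 : ‖x⁻¹ ^ (n+1)‖ ≤ R ^ (n+1) := by rw [norm_pow]; gcongr
    have hR3 : (3 * R) ^ n ≤ (3:ℝ) ^ n * R ^ (n+1) := by
      rw [mul_pow]; gcongr
      omega
    have h3n : (1:ℝ) ≤ 3 ^ n := one_le_pow₀ (by norm_num)
    have hRp : 0 < R ^ (n+1) := by positivity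
    calc ‖x ^ (n+1) - x⁻¹ ^ (n+1+1)‖
        ≤ ‖x ^ n - x⁻¹ ^ (n+1)‖ + ‖1 - x⁻¹‖ * ‖x ^ (n+1) + x⁻¹ ^ (n+1)‖ := by
          rw [e, ← norm_mul]; exact norm_add_le _ _
      _ ≤ ‖1 - x⁻¹‖ * (3 * R) ^ n + ‖1 - x⁻¹‖ * (R ^ (n+1) + R ^ (n+1)) := by
          gcongr
          exact (norm_add_le _ _).trans (add_le_add hb1 hb2)
      _ = ‖1 - x⁻¹‖ * ((3 * R) ^ n + (R ^ (n+1) + R ^ (n+1))) := by ring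
      _ ≤ ‖1 - x⁻¹‖ * (3 * R) ^ (n+1) := by
          gcongr
          rw [mul_pow 3 R (n+1), pow_succ 3 n]
          nlinarith

/-- Paired form of the theta series. -/
lemma hasSum_pair (z : ℂ) :
    HasSum (fun n : ℕ => (-1) ^ n * cexp (Real.pi * I * ω) ^ (n * (n+1)) *
      (cexp (2 * Real.pi * I * z) ^ n - (cexp (2 * Real.pi * I * z))⁻¹ ^ (n+1)))
      (jacobiTheta₂ (z + 1/2 + ω / 2) ω) := by
  have h := (hasSum_jacobiTheta₂_term (z + 1/2 + ω / 2) omega_im_pos).nat_add_neg_add_one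
  convert h using 1
  funext n
  symm
  rw [← Complex.exp_neg, ← Complex.exp_nat_mul, ← Complex.exp_nat_mul, ← Complex.exp_nat_mul,
    ← Complex.exp_pi_mul_I, ← Complex.exp_nat_mul, mul_sub, ← Complex.exp_add, ← Complex.exp_add,
    ← Complex.exp_add, jacobiTheta₂_term, jacobiTheta₂_term, sub_eq_add_neg]
  congr 1
  · congr 1
    push_cast; ring
  · have e : ∀ a : ℂ, -cexp a = cexp (a - (2 * n + 1 : ℤ) * (Real.pi * I)) := by
      intro a
      have : a - (2 * n + 1 : ℤ) * (Real.pi * I)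
          = a - Real.pi * I - (n : ℤ) * (2 * Real.pi * I) := by push_cast; ring
      rw [this, Complex.exp_sub, Complex.exp_int_mul_two_pi_mul_I, Complex.exp_sub,
        Complex.exp_pi_mul_I]
      rw [div_neg, div_one, div_one]
    rw [e]
    congr 1
    push_cast; ring

lemma r_lt : Real.exp (-(Real.pi * (Real.sqrt 3 / 2))) < 1 / 7 := by
  have h3 : (1.7 : ℝ) ≤ Real.sqrt 3 := Real.le_sqrt_of_sq_le (by norm_num)
  have hpi := Real.pi_gt_three
  have h2 : (2:ℝ) ≤ Real.pi * (Real.sqrt 3 / 2) := by nlinarith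
  have he := Real.exp_one_gt_d9
  have h7 : (7:ℝ) < Real.exp 2 := by
    have : Real.exp 2 = Real.exp 1 * Real.exp 1 := by rw [← Real.exp_add]; norm_num
    rw [this]; nlinarith
  calc Real.exp (-(Real.pi * (Real.sqrt 3 / 2))) ≤ Real.exp (-2) := by gcongr
    _ = 1 / Real.exp 2 := by rw [Real.exp_neg, one_div]
    _ < 1 / 7 := by gcongr

lemma theta_zero_strip (z : ℂ) (hz : |z.im| ≤ Real.sqrt 3 / 4) (h0 : θf z = 0) :
    ∃ m : ℤ, z = m := by
  have hJ : jacobiTheta₂ (z + 1/2 + ω / 2) ω = 0 := by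
    rw [theta_eq] at h0
    simpa [Complex.exp_ne_zero] using h0
  have hs := hasSum_pair z
  rw [hJ] at hs
  set x := cexp (2 * Real.pi * I * z) with hxdef
  have hx : x ≠ 0 := Complex.exp_ne_zero _
  set r := Real.exp (-(Real.pi * (Real.sqrt 3 / 2))) with hr
  have hr0 : 0 < r := Real.exp_pos _
  have hr7 : r < 1 / 7 := r_lt
  have hq : ‖cexp (Real.pi * I * ω)‖ = r := by
    rw [Complex.norm_exp, hr]
    congr 1
    simp [omega_im]
  have hRinv : r⁻¹ = Real.exp (Real.pi * (Real.sqrt 3 / 2)) := by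
    rw [hr, Real.exp_neg, inv_inv]
  have hre : (2 * Real.pi * I * z).re = -(2 * Real.pi * z.im) := by simp
  have hpi := Real.pi_pos
  have hz' := abs_le.1 hz
  have hx1 : ‖x‖ ≤ r⁻¹ := by
    rw [hRinv, hxdef, Complex.norm_exp, hre]
    apply Real.exp_le_exp.2
    nlinarith
  have hx2 : ‖x⁻¹‖ ≤ r⁻¹ := by
    rw [hRinv, hxdef, ← Complex.exp_neg, Complex.norm_exp, Complex.neg_re, hre]
    apply Real.exp_le_exp.2
    nlinarith
  have hR1 : 1 ≤ r⁻¹ := by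
    rw [one_le_inv₀ hr0]; linarith
  have hb : ∀ n : ℕ, ‖(-1) ^ n * cexp (Real.pi * I * ω) ^ (n * (n+1)) *
      (x ^ n - x⁻¹ ^ (n+1))‖ ≤ ‖1 - x⁻¹‖ * (3 * r) ^ n := by
    intro n
    rw [norm_mul, norm_mul, norm_pow, norm_pow, hq, norm_neg, norm_one, one_pow, one_mul]
    have hd := d_bound x hx r⁻¹ hR1 hx1 hx2 n
    calc r ^ (n * (n+1)) * ‖x ^ n - x⁻¹ ^ (n+1)‖
        ≤ r ^ (n * (n+1)) * (‖1 - x⁻¹‖ * (3 * r⁻¹) ^ n) := by gcongr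
      _ = ‖1 - x⁻¹‖ * (3 ^ n * r ^ (n * n)) := by
          rw [mul_pow, mul_add, pow_add, mul_one, inv_pow]
          field_simp
      _ ≤ ‖1 - x⁻¹‖ * (3 * r) ^ n := by
          rw [mul_pow]
          refine mul_le_mul_of_nonneg_left (mul_le_mul_of_nonneg_left ?_ (by positivity))
            (norm_nonneg _)
          exact pow_le_pow_of_le_one hr0.le (by linarith) (Nat.le_mul_self n)
  have hs1 := (hasSum_nat_add_iff' 1).2 hs
  have hg : HasSum (fun n : ℕ => ‖1 - x⁻¹‖ * (3 * r) ^ (n+1))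
      (‖1 - x⁻¹‖ * (3 * r * (1 - 3 * r)⁻¹)) := by
    have := ((hasSum_geometric_of_lt_one (r := 3 * r) (by positivity) (by linarith)).mul_left
      (3 * r)).mul_left ‖1 - x⁻¹‖
    simpa only [← pow_succ'] using this
  have hle : ‖1 - x⁻¹‖ ≤ ‖1 - x⁻¹‖ * (3 * r * (1 - 3 * r)⁻¹) := by
    have := hs1.norm_le_of_bounded hg (fun n => hb (n+1))
    simpa [norm_sub_rev] using this
  have hlt : 3 * r * (1 - 3 * r)⁻¹ < 1 := by
    rw [← div_eq_mul_inv, div_lt_one (by linarith)]; linarith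
  have hz0 : ‖1 - x⁻¹‖ = 0 := by
    by_contra hne
    have : 0 < ‖1 - x⁻¹‖ := lt_of_le_of_ne (norm_nonneg _) (Ne.symm hne)
    nlinarith
  have hx1' : x = 1 := by
    rw [norm_eq_zero, sub_eq_zero] at hz0
    exact inv_eq_one.1 hz0.symm
  rw [hxdef, Complex.exp_eq_one_iff] at hx1'
  obtain ⟨m, hm⟩ := hx1'
  refine ⟨m, ?_⟩
  have h2 : (2 * Real.pi * I : ℂ) ≠ 0 := Complex.two_pi_I_ne_zero
  apply mul_left_cancel₀ h2
  rw [hm]; ring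

lemma theta_zero (z : ℂ) (h0 : θf z = 0) : z ∈ Lam := by
  set n := round (z.im / (Real.sqrt 3 / 2)) with hn
  have h3 : 0 < Real.sqrt 3 / 2 := by positivity
  have hr := abs_sub_round (z.im / (Real.sqrt 3 / 2))
  rw [← hn] at hr
  have hz : |(z + ((-n : ℤ) : ℂ) * ω).im| ≤ Real.sqrt 3 / 4 := by
    have : (z + ((-n : ℤ) : ℂ) * ω).im = (z.im / (Real.sqrt 3 / 2) - n) * (Real.sqrt 3 / 2) := by
      simp [omega_im]
      field_simp
      ring
    rw [this, abs_mul, abs_of_pos h3]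
    nlinarith
  obtain ⟨m, hm⟩ := theta_zero_strip _ hz ((theta_add_int_omega _ _).2 h0)
  refine ⟨m, n, ?_⟩
  rw [← hm]; push_cast; ring

lemma exp_fd (k z : ℂ) : HasFDerivAt (𝕜 := ℝ) (fun z : ℂ => I / 2 * (z - conj z) * k)
    ((I / 2 * k) • (ContinuousLinearMap.id ℝ ℂ - (conjCLE : ℂ →L[ℝ] ℂ))) z := by
  have h := ((hasFDerivAt_id (𝕜 := ℝ) z).sub
    ((conjCLE : ℂ →L[ℝ] ℂ).hasFDerivAt (x := z))).const_mul (I / 2 * k)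
  have e : (fun z : ℂ => I / 2 * (z - conj z) * k) =
      fun y => I / 2 * k * ((id : ℂ → ℂ) - (⇑(conjCLE : ℂ →L[ℝ] ℂ) : ℂ → ℂ)) y := by
    funext w; simp; ring
  rw [e]
  exact h

/-- F_k is smooth off the lattice Λ and satisfies (2D_z̄ + k)F_k = 0 there. -/
theorem stmt12 (k : ℂ) :
    ContDiffOn ℝ (⊤ : ℕ∞) (Fk k) (Lamᶜ) ∧
    ∀ z : ℂ, z ∉ Lam → twoDbar (Fk k) z + k * Fk k z = 0 := by
  have hθ : ContDiff ℝ (⊤ : ℕ∞) θf :=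
    (theta_differentiable.contDiff (n := (⊤ : ℕ∞))).restrict_scalars ℝ
  constructor
  · have hc : ContDiff ℝ (⊤ : ℕ∞) (fun z : ℂ => conj z) :=
      (conjCLE : ℂ →L[ℝ] ℂ).contDiff
    have hnum : ContDiff ℝ (⊤ : ℕ∞)
        (fun z : ℂ => cexp (I / 2 * (z - conj z) * k) * θf (z - zpt k)) := by
      refine ContDiff.mul ?_ (hθ.comp (contDiff_id.sub contDiff_const))
      exact ((contDiff_const.mul (contDiff_id.sub hc)).mul contDiff_const).cexp
    have hinv : ContDiffOn ℝ (⊤ : ℕ∞) (fun z => (θf z)⁻¹) Lamᶜ :=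
      (hθ.contDiffOn (s := Lamᶜ)).inv fun z hz h => hz (theta_zero z h)
    exact ((hnum.contDiffOn (s := Lamᶜ)).mul hinv).congr fun z _ => by
      rw [Fk, div_eq_mul_inv]
  · intro z hz
    have hne : θf z ≠ 0 := fun h => hz (theta_zero z h)
    have hg : DifferentiableAt ℂ (fun z => θf (z - zpt k) / θf z) z := by
      refine DifferentiableAt.div ?_ (theta_differentiable z) hne
      exact DifferentiableAt.comp (g := θf) (f := fun z => z - zpt k) z (theta_differentiable _) (by fun_prop)
    obtain ⟨g', hg'⟩ : ∃ g', HasDerivAt (fun z => θf (z - zpt k) / θf z) g' z :=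
      ⟨_, hg.hasDerivAt⟩
    have hF := (exp_fd k z).cexp.mul (hg'.hasFDerivAt.restrictScalars ℝ)
    have hfun : Fk k = (fun z : ℂ => cexp (I / 2 * (z - conj z) * k)) *
        (fun z => θf (z - zpt k) / θf z) := by
      ext w; simp [Fk, mul_div_assoc]
    rw [← hfun] at hF
    rw [twoDbar, hF.fderiv, hfun]
    simp
    ring_nf
    simp
end
end

section
/- Let U, D(α) and the L²₀ boundary condition be as in the context, and let α ∈ ℂ. Let 𝒦 be the set of smooth functions u : ℂ → ℂ² satisfying the L²₀ boundary condition and D(α)u = 0. Assume 𝒦 contains a nonzero element u₀ and that every element of 𝒦 is a complex scalar multiple of u₀ (i.e., the kernel is one-dimensional). Then u₀(ωz) = ω·u₀(z) for all z ∈ ℂ; in particular u₀(0) = 0. Moreover there is a smooth w : ℂ → ℂ² with u₀(z) = z·w(z) and w(0) ≠ 0, and u₀(z) ≠ 0 for every z ∉ Λ. -/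
noncomputable section

open Complex ComplexConjugate

open Filter Topology MeasureTheory

/-- Weighted radial average. -/
def radAvg {E : Type*} [NormedAddCommGroup E] [NormedSpace ℝ E] (k : ℕ) (F : ℂ → E) (z : ℂ) : E :=
  ∫ t in (0:ℝ)..1, t ^ k • F (t • z)

lemma radAvg_hasFDerivAt {E : Type*} [NormedAddCommGroup E] [NormedSpace ℝ E]
    (k : ℕ) (F : ℂ → E) (hF : ContDiff ℝ 1 F) (z : ℂ) :
    HasFDerivAt (radAvg k F) (radAvg (k+1) (fderiv ℝ F) z) z := by
  have hc : Continuous F := hF.continuous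
  have hc' : Continuous (fderiv ℝ F) := hF.continuous_fderiv (by simp)
  obtain ⟨C, hC⟩ := (isCompact_closedBall (0:ℂ) (‖z‖+1)).exists_bound_of_continuousOn
    hc'.continuousOn
  unfold radAvg
  refine intervalIntegral.hasFDerivAt_integral_of_dominated_of_fderiv_le (𝕜 := ℝ)
    (F := fun z (t:ℝ) => t ^ k • F (t • z))
    (F' := fun z (t:ℝ) => t ^ (k+1) • fderiv ℝ F (t • z)) (bound := fun _ => C)
    (s := Metric.ball z 1) (Metric.ball_mem_nhds z one_pos) ?_ ?_ ?_ ?_ ?_ ?_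
  · exact Eventually.of_forall fun x => (by fun_prop : Continuous fun t : ℝ => t ^ k • F (t • x)).aestronglyMeasurable
  · exact (by fun_prop : Continuous fun t : ℝ => t ^ k • F (t • z)).intervalIntegrable _ _
  · exact (by fun_prop : Continuous fun t : ℝ => t ^ (k+1) • fderiv ℝ F (t • z)).aestronglyMeasurable
  · refine Eventually.of_forall fun t ht x hx => ?_
    rw [Set.uIoc_of_le zero_le_one] at ht
    have hx' : ‖x‖ ≤ ‖z‖ + 1 := by
      have := norm_le_norm_add_norm_sub' x z
      rw [Metric.mem_ball, dist_eq_norm] at hx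
      linarith
    have h1 : ‖fderiv ℝ F (t • x)‖ ≤ C := by
      apply hC
      rw [mem_closedBall_zero_iff, norm_smul, Real.norm_of_nonneg ht.1.le]
      nlinarith [norm_nonneg x, ht.2]
    rw [norm_smul, norm_pow, Real.norm_of_nonneg ht.1.le]
    have h2 : t ^ (k+1) ≤ 1 := pow_le_one₀ ht.1.le ht.2
    have h3 : 0 ≤ t ^ (k+1) := pow_nonneg ht.1.le _
    nlinarith [norm_nonneg (fderiv ℝ F (t • x))]
  · exact intervalIntegrable_const
  · refine Eventually.of_forall fun t ht x hx => ?_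
    have h1 : HasFDerivAt F (fderiv ℝ F (t • x)) (t • x) :=
      (hF.differentiable (by simp) _).hasFDerivAt
    have h2 : HasFDerivAt (fun x : ℂ => t • x) (t • ContinuousLinearMap.id ℝ ℂ) x :=
      (hasFDerivAt_id x).const_smul t
    have h3 := (h1.comp x h2).const_smul (t ^ k)
    refine h3.congr_fderiv ?_
    ext
    simp [pow_succ, smul_smul]

lemma radAvg_contDiff_nat {E : Type*} [NormedAddCommGroup E] [NormedSpace ℝ E]
    (n : ℕ) (k : ℕ) (F : ℂ → E) (hF : ContDiff ℝ (⊤ : ℕ∞) F) : ContDiff ℝ n (radAvg k F) := by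
  induction n generalizing E k with
  | zero =>
    simp only [Nat.cast_zero, contDiff_zero]
    exact continuous_iff_continuousAt.2 fun z =>
      (radAvg_hasFDerivAt k F (hF.of_le (by exact_mod_cast le_top)) z).continuousAt
  | succ n ih =>
    rw [Nat.cast_succ, contDiff_succ_iff_hasFDerivAt]
    refine ⟨radAvg (k+1) (fderiv ℝ F), ih _ _ ?_, fun z => radAvg_hasFDerivAt k F (hF.of_le (by exact_mod_cast le_top)) z⟩
    exact hF.fderiv_right (m := (⊤ : ℕ∞)) (by simp)

lemma radAvg_contDiff {E : Type*} [NormedAddCommGroup E] [NormedSpace ℝ E]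
    (k : ℕ) (F : ℂ → E) (hF : ContDiff ℝ (⊤ : ℕ∞) F) : ContDiff ℝ (⊤ : ℕ∞) (radAvg k F) :=
  contDiff_infty.2 fun n => radAvg_contDiff_nat n k F hF

section division
variable {E : Type*} [NormedAddCommGroup E] [NormedSpace ℂ E] [CompleteSpace E]

lemma hadamard_aux (u : ℂ → E) (hu : ContDiff ℝ (⊤ : ℕ∞) u) (h0 : u 0 = 0) (z : ℂ) :
    u z = z • radAvg 0 (fun w => (2⁻¹ : ℂ) • (fderiv ℝ u w 1 - I • fderiv ℝ u w I)) z
      + conj z • radAvg 0 (fun w => (2⁻¹ : ℂ) • (fderiv ℝ u w 1 + I • fderiv ℝ u w I)) z := by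
  have hc' : Continuous (fderiv ℝ u) := hu.continuous_fderiv (by simp)
  have hFTC : ∫ t in (0:ℝ)..1, fderiv ℝ u (t • z) z = u ((1:ℝ) • z) - u ((0:ℝ) • z) := by
    refine intervalIntegral.integral_eq_sub_of_hasDerivAt (f := fun t : ℝ => u (t • z)) ?_ ?_
    · intro t _
      have h1 : HasFDerivAt u (fderiv ℝ u (t • z)) (t • z) :=
        (hu.differentiable (by simp) _).hasFDerivAt
      have h2 : HasDerivAt (fun t : ℝ => t • z) ((1:ℝ) • z) t := (hasDerivAt_id t).smul_const z
      simpa using! h1.comp_hasDerivAt t h2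
    · exact (by fun_prop : Continuous fun t : ℝ => fderiv ℝ u (t • z) z).intervalIntegrable _ _
  simp only [one_smul, zero_smul, h0, sub_zero] at hFTC
  rw [← hFTC]
  unfold radAvg
  rw [← intervalIntegral.integral_smul, ← intervalIntegral.integral_smul,
    ← intervalIntegral.integral_add]
  · congr 1
    ext t
    have hz : z = z.re • (1:ℂ) + z.im • I := by simp [Complex.re_add_im]
    conv_lhs => rw [hz]
    set L := fderiv ℝ u (t • z)
    have : L (z.re • (1:ℂ) + z.im • I) = z.re • L 1 + z.im • L I := by simp only [map_add, map_smul]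
    have hz' : z = (z.re : ℂ) + z.im * I := (Complex.re_add_im z).symm
    have hzc : conj z = (z.re : ℂ) - z.im * I := by apply Complex.ext <;> simp
    have e : L (z.re • (1:ℂ) + z.im • I) = (z.re : ℂ) • L 1 + (z.im : ℂ) • L I := by
      rw [this, Complex.coe_smul, Complex.coe_smul]
    rw [← hz]
    rw [← hz] at e
    rw [e, hzc]
    have e2 : z • (2⁻¹ : ℂ) • (L 1 - I • L I) = ((z.re : ℂ) + z.im * I) • (2⁻¹ : ℂ) • (L 1 - I • L I) := by
      rw [← hz']
    simp only [pow_zero, one_smul]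
    rw [e2]
    have hI : I * I = -1 := Complex.I_mul_I
    match_scalars
    · ring
    · linear_combination ((z.im:ℂ)) * hI
  · exact (by fun_prop : Continuous fun t : ℝ => z • t ^ 0 • (2⁻¹ : ℂ) • (fderiv ℝ u (t • z) 1 - I • fderiv ℝ u (t • z) I)).intervalIntegrable _ _
  · exact (by fun_prop : Continuous fun t : ℝ => conj z • t ^ 0 • (2⁻¹ : ℂ) • (fderiv ℝ u (t • z) 1 + I • fderiv ℝ u (t • z) I)).intervalIntegrable _ _

lemma division_aux (u : ℂ → E) (hu : ContDiff ℝ (⊤ : ℕ∞) u) (h0 : u 0 = 0)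
    (A : ℂ → E →L[ℂ] E) (hA : ContDiff ℝ (⊤ : ℕ∞) A)
    (heq : ∀ z, fderiv ℝ u z 1 + I • fderiv ℝ u z I = A z (u z)) (n : ℕ) :
    ∃ a b : ℂ → E, ContDiff ℝ (⊤ : ℕ∞) a ∧ ContDiff ℝ (⊤ : ℕ∞) b ∧
      ∀ z, u z = z • a z + (conj z) ^ n • b z := by
  induction n with
  | zero => exact ⟨0, u, contDiff_const, hu, fun z => by simp⟩
  | succ n ih =>
    obtain ⟨a, b, ha, hb, hab⟩ := ih
    have hAR : ∀ f : ℂ → E, ContDiff ℝ (⊤ : ℕ∞) f → ContDiff ℝ (⊤ : ℕ∞) (fun z => (2⁻¹ : ℂ) • A z (f z)) := by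
      intro f hf
      have : ContDiff ℝ (⊤ : ℕ∞) (fun z => (ContinuousLinearMap.restrictScalarsL ℂ E E ℝ ℝ) (A z)) :=
        (ContinuousLinearMap.contDiff _).comp hA
      exact (this.clm_apply hf).const_smul (2⁻¹ : ℂ)
    have hd : ContDiff ℝ (⊤ : ℕ∞) (fderiv ℝ u) := hu.fderiv_right (m := (⊤ : ℕ∞)) (by simp)
    refine ⟨fun z => radAvg 0 (fun w => (2⁻¹ : ℂ) • (fderiv ℝ u w 1 - I • fderiv ℝ u w I)) z
      + conj z • radAvg 1 (fun w => (2⁻¹ : ℂ) • A w (a w)) z,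
      radAvg n (fun w => (2⁻¹ : ℂ) • A w (b w)), ?_, ?_, ?_⟩
    · refine (radAvg_contDiff _ _ ?_).add ?_
      · exact ((hd.clm_apply contDiff_const).sub ((hd.clm_apply contDiff_const).const_smul I)).const_smul (2⁻¹ : ℂ)
      · exact (Complex.conjCLE.contDiff).smul (radAvg_contDiff _ _ (hAR a ha))
    · exact radAvg_contDiff _ _ (hAR b hb)
    · intro z
      rw [hadamard_aux u hu h0 z]
      have : radAvg 0 (fun w => (2⁻¹ : ℂ) • (fderiv ℝ u w 1 + I • fderiv ℝ u w I)) z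
          = z • radAvg 1 (fun w => (2⁻¹ : ℂ) • A w (a w)) z
            + (conj z)^n • radAvg n (fun w => (2⁻¹ : ℂ) • A w (b w)) z := by
        have c1 := (hAR a ha).continuous
        have c2 := (hAR b hb).continuous
        unfold radAvg
        rw [← intervalIntegral.integral_smul, ← intervalIntegral.integral_smul,
          ← intervalIntegral.integral_add]
        · congr 1
          ext t
          beta_reduce
          rw [heq, hab (t • z)]
          simp only [map_add, map_smul, Complex.real_smul, map_mul, Complex.conj_ofReal, mul_pow, pow_zero, one_smul, pow_one]
          simp only [← Complex.coe_smul (_ : ℝ) (_ : E)]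
          match_scalars <;> push_cast <;> ring
        · exact (by fun_prop : Continuous fun t : ℝ => z • t ^ 1 • (2⁻¹ : ℂ) • A (t • z) (a (t • z))).intervalIntegrable _ _
        · exact (by fun_prop : Continuous fun t : ℝ => (conj z)^n • t ^ n • (2⁻¹ : ℂ) • A (t • z) (b (t • z))).intervalIntegrable _ _
      rw [this]
      match_scalars <;> ring

end division

/-- The functions `conj z ^ n / z ^ m`. -/
lemma conj_pow_div_contDiff (k n m : ℕ) (h : m + k + 1 ≤ n) :
    ContDiff ℝ k (fun z : ℂ => (conj z) ^ n / z ^ m) := by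
  induction k generalizing n m with
  | zero =>
    simp only [Nat.cast_zero, contDiff_zero]
    rw [continuous_iff_continuousAt]
    intro z
    by_cases hz : z = 0
    · subst hz
      have h1 : ∀ z : ℂ, ‖(conj z) ^ n / z ^ m‖ = ‖z‖ ^ (n - m) := by
        intro z
        by_cases hz : z = 0
        · subst hz
          simp [show n ≠ 0 by omega, show n - m ≠ 0 by omega]
        · rw [norm_div, norm_pow, norm_pow, Complex.norm_conj, pow_sub₀ _ (norm_ne_zero_iff.2 hz) (by omega)]
          rfl
      rw [ContinuousAt, map_zero, zero_pow (by omega), zero_div, tendsto_zero_iff_norm_tendsto_zero]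
      simp_rw [h1]
      have : Continuous fun z : ℂ => ‖z‖ ^ (n-m) := by fun_prop
      convert this.tendsto 0
      simp [show n - m ≠ 0 by omega]
    · exact ContinuousAt.div (by fun_prop) (by fun_prop) (pow_ne_zero _ hz)
  | succ k ih =>
    rw [Nat.cast_succ, contDiff_succ_iff_hasFDerivAt]
    refine ⟨fun z => ((n:ℂ) * ((conj z) ^ (n-1) / z ^ m)) • (Complex.conjCLE : ℂ →L[ℝ] ℂ)
      - ((m:ℂ) * ((conj z) ^ n / z ^ (m+1))) • ContinuousLinearMap.id ℝ ℂ, ?_, ?_⟩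
    · refine ContDiff.sub ?_ ?_
      · exact (contDiff_const.mul (ih (n-1) m (by omega))).smul contDiff_const
      · exact (contDiff_const.mul (ih n (m+1) (by omega))).smul contDiff_const
    · intro z
      by_cases hz : z = 0
      · subst hz
        have : ((n:ℂ) * ((conj (0:ℂ)) ^ (n-1) / (0:ℂ) ^ m)) • (Complex.conjCLE : ℂ →L[ℝ] ℂ)
          - ((m:ℂ) * ((conj (0:ℂ)) ^ n / (0:ℂ) ^ (m+1))) • ContinuousLinearMap.id ℝ ℂ = 0 := by
          ext x
          simp [show n ≠ 0 by omega, show n - 1 ≠ 0 by omega]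
        beta_reduce
        rw [this]
        have hb : (fun z : ℂ => (conj z) ^ n / z ^ m) =O[𝓝 0] fun z => ‖z‖ ^ 2 := by
          refine Asymptotics.IsBigO.of_bound 1 ?_
          filter_upwards [Metric.ball_mem_nhds (0:ℂ) one_pos] with z hz1
          rw [mem_ball_zero_iff] at hz1
          by_cases hz : z = 0
          · subst hz
            simp [show n ≠ 0 by omega]
          · rw [norm_div, norm_pow, norm_pow, Complex.norm_conj, one_mul, norm_pow, norm_norm,
              div_eq_mul_inv, ← pow_sub₀ _ (norm_ne_zero_iff.2 hz) (by omega)]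
            exact pow_le_pow_of_le_one (norm_nonneg z) hz1.le (by omega)
        rw [hasFDerivAt_iff_isLittleO]
        simp only [map_zero, sub_zero, ContinuousLinearMap.zero_apply]
        rw [zero_pow (by omega), zero_div]
        simp only [sub_zero]
        refine hb.trans_isLittleO ?_
        have := Asymptotics.isLittleO_norm_pow_id (E' := ℂ) (one_lt_two)
        exact this
      · have h1 : HasFDerivAt (fun z : ℂ => conj z) (Complex.conjCLE : ℂ →L[ℝ] ℂ) z :=
          Complex.conjCLE.hasFDerivAt
        have h2 := h1.pow n
        have h3 : HasFDerivAt (fun z : ℂ => z) (ContinuousLinearMap.id ℝ ℂ) z := hasFDerivAt_id z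
        have h5 : HasDerivAt (fun z : ℂ => (z ^ m)⁻¹) _ z := (hasDerivAt_pow m z).fun_inv (pow_ne_zero _ hz)
        have h4 := h2.fun_mul (h5.hasFDerivAt.restrictScalars ℝ)
        simp only [div_eq_mul_inv]
        refine h4.congr_fderiv ?_
        rcases m with _ | m
        · ext <;> simp <;> ring
        · ext <;> simp <;> field_simp <;> ring


section generic
variable {E : Type*} [NormedAddCommGroup E] [NormedSpace ℂ E]

/-- The vector-valued Cauchy-Riemann operator. -/
def dbarV (u : ℂ → E) (z : ℂ) : E := fderiv ℝ u z 1 + I • fderiv ℝ u z I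

lemma dbarV_continuous {u : ℂ → E} (hu : ContDiff ℝ (⊤ : ℕ∞) u) : Continuous (dbarV u) := by
  have hc' : Continuous (fderiv ℝ u) := hu.continuous_fderiv (by simp)
  unfold dbarV
  fun_prop

lemma dbarV_smul {f : ℂ → ℂ} {u : ℂ → E} {z : ℂ} (hf : DifferentiableAt ℂ f z)
    (hu : DifferentiableAt ℝ u z) : dbarV (fun w => f w • u w) z = f z • dbarV u z := by
  have h1 := hf.hasDerivAt.hasFDerivAt.restrictScalars ℝ
  have h2 := (h1.fun_smul hu.hasFDerivAt).fderiv
  unfold dbarV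
  rw [h2]
  simp
  have hI : I * I = -1 := Complex.I_mul_I
  match_scalars
  · ring
  · linear_combination (deriv f z) * hI
  · ring

lemma dbarV_congr {u v : ℂ → E} {z : ℂ} (h : u =ᶠ[𝓝 z] v) : dbarV u z = dbarV v z := by
  unfold dbarV; rw [h.fderiv_eq]

/-- Two continuous functions agreeing on a punctured neighbourhood agree at the point. -/
lemma eq_of_punctured {F : Type*} [TopologicalSpace F] [T2Space F] {u v : ℂ → F} {z : ℂ}
    (hu : ContinuousAt u z) (hv : ContinuousAt v z) (h : u =ᶠ[𝓝[≠] z] v) : u z = v z :=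
  tendsto_nhds_unique (hu.tendsto.mono_left nhdsWithin_le_nhds)
    ((tendsto_congr' h).2 (hv.tendsto.mono_left nhdsWithin_le_nhds))

variable [CompleteSpace E]

lemma division_zero (u : ℂ → E) (hu : ContDiff ℝ (⊤ : ℕ∞) u) (h0 : u 0 = 0)
    (A : ℂ → E →L[ℂ] E) (hA : ContDiff ℝ (⊤ : ℕ∞) A)
    (heq : ∀ z, dbarV u z = A z (u z)) :
    ∃ W : ℂ → E, ContDiff ℝ (⊤ : ℕ∞) W ∧ ∀ z, u z = z • W z := by
  have key : ∀ k : ℕ, ∃ W : ℂ → E, ContDiff ℝ k W ∧ ∀ z, u z = z • W z := by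
    intro k
    obtain ⟨a, b, ha, hb, hab⟩ := division_aux u hu h0 A hA heq (k+2)
    refine ⟨fun z => a z + ((conj z)^(k+2) / z^1) • b z, ?_, ?_⟩
    · exact (ha.of_le (by exact_mod_cast le_top)).add
        ((conj_pow_div_contDiff k (k+2) 1 (by omega)).smul (hb.of_le (by exact_mod_cast le_top)))
    · intro z
      by_cases hz : z = 0
      · subst hz; simp [h0]
      · rw [hab z, smul_add, smul_smul, pow_one, mul_div_cancel₀ _ hz]
  choose W hW hWu using key
  refine ⟨W 0, contDiff_infty.2 fun n => ?_, hWu 0⟩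
  have : W 0 = W n := by
    have hne : ∀ z : ℂ, z ≠ 0 → W 0 z = W n z := by
      intro z hz
      have := (hWu 0 z).symm.trans (hWu n z)
      exact (smul_right_injective E hz) this
    ext z
    refine eq_of_punctured (hW 0).continuous.continuousAt (hW n).continuous.continuousAt ?_
    by_cases hz : z = 0
    · subst hz
      filter_upwards [self_mem_nhdsWithin] with y hy using hne y hy
    · exact ((eventually_ne_nhds hz).mono hne).filter_mono nhdsWithin_le_nhds
  rw [this]
  exact hW n

lemma division (u : ℂ → E) (hu : ContDiff ℝ (⊤ : ℕ∞) u) (z₀ : ℂ) (h0 : u z₀ = 0)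
    (A : ℂ → E →L[ℂ] E) (hA : ContDiff ℝ (⊤ : ℕ∞) A)
    (heq : ∀ z, dbarV u z = A z (u z)) :
    ∃ W : ℂ → E, ContDiff ℝ (⊤ : ℕ∞) W ∧ (∀ z, u z = (z - z₀) • W z) ∧
      ∀ z, dbarV W z = A z (W z) := by
  obtain ⟨W, hW, hWu⟩ := division_zero (fun z => u (z + z₀)) (hu.comp (contDiff_id.add contDiff_const))
    (by simpa using h0) (fun z => A (z + z₀)) (hA.comp (contDiff_id.add contDiff_const)) (by
      intro z
      rw [← heq]
      unfold dbarV
      rw [fderiv_comp_add_right])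
  have hW' : ContDiff ℝ (⊤ : ℕ∞) (fun z => W (z - z₀)) := hW.comp (contDiff_id.sub contDiff_const)
  have hu' : ∀ z, u z = (z - z₀) • W (z - z₀) := fun z => by rw [← hWu]; simp
  refine ⟨fun z => W (z - z₀), hW', hu', ?_⟩
  have hne : ∀ z, z ≠ z₀ → dbarV (fun z => W (z - z₀)) z = A z (W (z - z₀)) := by
    intro z hz
    have h1 := dbarV_smul (f := fun z => z - z₀) (u := fun z => W (z - z₀)) (z := z) (by fun_prop)
      (hW'.differentiable (by simp) z)
    rw [← funext hu', heq, hu' z, map_smul] at h1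
    exact (smul_right_injective E (sub_ne_zero.2 hz) h1).symm
  intro z
  by_cases hz : z = z₀
  · subst hz
    have hAc := hA.continuous
    have hWc := hW.continuous
    refine eq_of_punctured (v := fun y => A y (W (y - z))) (dbarV_continuous hW').continuousAt (by fun_prop) ?_
    filter_upwards [self_mem_nhdsWithin] with y hy using hne y hy
  · exact hne z hz

lemma engine (S : Set ℂ) (χ : ℂ → E →L[ℂ] E) (A : ℂ → E →L[ℂ] E) (hA : ContDiff ℝ (⊤ : ℕ∞) A)
    (u : ℂ → E) (hu : ContDiff ℝ (⊤ : ℕ∞) u) (hbc : ∀ γ ∈ S, ∀ z, u (z + γ) = χ γ (u z))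
    (heq : ∀ z, dbarV u z = A z (u z)) (hne : ∃ z, u z ≠ 0)
    (hker : ∀ v : ℂ → E, ContDiff ℝ (⊤ : ℕ∞) v → (∀ γ ∈ S, ∀ z, v (z + γ) = χ γ (v z)) →
      (∀ z, dbarV v z = A z (v z)) → ∃ c : ℂ, v = c • u)
    (f : ℂ → ℂ) (hf : ∀ z, MeromorphicAt f z) (hper : ∀ γ ∈ S, ∀ z, f (z + γ) = f z)
    (hext : ∀ z, ∃ v : ℂ → E, ContDiffAt ℝ (⊤ : ℕ∞) v z ∧ v =ᶠ[𝓝[≠] z] fun w => f w • u w)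
    (q : ℂ) (hq : meromorphicOrderAt f q < 0) : False := by
  choose v hv hvf using hext
  set V : ℂ → E := fun z => v z z with hVdef
  -- V agrees with v z near z
  have hVv : ∀ z, V =ᶠ[𝓝 z] v z := by
    intro z
    have hp : V =ᶠ[𝓝[≠] z] v z := by
      have h1 : ∀ᶠ y in 𝓝[≠] z, ContinuousAt (v z) y :=
        (((hv z).of_le (m := 1) (by exact_mod_cast le_top)).eventually (by simp)).filter_mono nhdsWithin_le_nhds
          |>.mono fun y hy => hy.continuousAt
      have h2 : ∀ᶠ y in 𝓝[≠] z, v z =ᶠ[𝓝[≠] y] fun w => f w • u w := by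
        have := eventually_eventually_nhdsWithin.2 (hvf z)
        filter_upwards [this, self_mem_nhdsWithin] with y hy hyz
        have hyz' : y ∈ ({z}ᶜ : Set ℂ) := hyz
        rw [isOpen_compl_singleton.nhdsWithin_eq hyz'] at hy
        exact hy.filter_mono nhdsWithin_le_nhds
      filter_upwards [h1, h2] with y hy1 hy2
      exact eq_of_punctured (u := v y) (hv y).continuousAt hy1 ((hvf y).trans hy2.symm)
    have := eventually_nhdsWithin_iff.1 hp
    filter_upwards [this] with y hy
    by_cases hyz : y = z
    · subst hyz; rfl
    · exact hy hyz
  have hVs : ContDiff ℝ (⊤ : ℕ∞) V :=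
    contDiff_iff_contDiffAt.2 fun z => (hv z).congr_of_eventuallyEq (hVv z)
  have hVf : ∀ z, V =ᶠ[𝓝[≠] z] fun w => f w • u w := fun z =>
    ((hVv z).filter_mono nhdsWithin_le_nhds).trans (hvf z)
  have huc := hu.continuous
  have hVc := hVs.continuous
  have hAc := hA.continuous
  have hVbc : ∀ γ ∈ S, ∀ z, V (z + γ) = χ γ (V z) := by
    intro γ hγ z
    refine eq_of_punctured (u := fun z => V (z + γ)) (v := fun z => χ γ (V z)) (by fun_prop) (by fun_prop) ?_
    have ht : Tendsto (fun y => y + γ) (𝓝[≠] z) (𝓝[≠] (z + γ)) := by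
      refine tendsto_nhdsWithin_iff.2 ⟨?_, ?_⟩
      · exact (by fun_prop : Continuous fun y : ℂ => y + γ).continuousAt.tendsto.mono_left nhdsWithin_le_nhds
      · filter_upwards [self_mem_nhdsWithin] with y hy
        simpa using hy
    filter_upwards [ht.eventually (hVf (z + γ)), hVf z] with y h1 h2
    rw [h1, h2, hper γ hγ, hbc γ hγ, map_smul]
  have hVeq : ∀ z, dbarV V z = A z (V z) := by
    intro z
    refine eq_of_punctured (v := fun y => A y (V y)) (dbarV_continuous hVs).continuousAt (by fun_prop) ?_
    have := eventually_eventually_nhdsWithin.2 (hVf z)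
    filter_upwards [this, self_mem_nhdsWithin, (hf z).eventually_analyticAt, hVf z] with y hy hyz hya hyf
    have hyz' : y ∈ ({z}ᶜ : Set ℂ) := hyz
    rw [isOpen_compl_singleton.nhdsWithin_eq hyz'] at hy
    rw [dbarV_congr hy, dbarV_smul hya.differentiableAt (hu.differentiable (by simp) y), heq, hyf, map_smul]
  obtain ⟨c, hc⟩ := hker V hVs hVbc hVeq
  obtain ⟨z₁, hz₁⟩ := hne
  have hmer : MeromorphicOn (fun z => f z - c) Set.univ := fun z _ => (hf z).sub (MeromorphicAt.const c z)
  have htop : meromorphicOrderAt (fun z => f z - c) z₁ = ⊤ := by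
    rw [meromorphicOrderAt_eq_top_iff]
    filter_upwards [hVf z₁, (huc.continuousAt.eventually_ne hz₁).filter_mono nhdsWithin_le_nhds] with y h1 h2
    rw [hc, Pi.smul_apply, ← sub_eq_zero, ← sub_smul, smul_eq_zero] at h1
    rcases h1 with h1 | h1
    · rw [← neg_sub, h1, neg_zero]
    · exact absurd h1 h2
  have htop' : meromorphicOrderAt (fun z => f z - c) q = ⊤ := by
    by_contra h
    exact hmer.meromorphicOrderAt_ne_top_of_isPreconnected isPreconnected_univ (Set.mem_univ q)
      (Set.mem_univ z₁) h htop
  rw [meromorphicOrderAt_eq_top_iff] at htop'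
  have h1 := tendsto_norm_cobounded_atTop.comp (tendsto_cobounded_of_meromorphicOrderAt_neg hq)
  have h2 := (h1.eventually_gt_atTop ‖c‖).and htop'
  obtain ⟨y, hy1, hy2⟩ := h2.exists
  have hy3 : f y = c := sub_eq_zero.1 hy2
  simp only [Function.comp_apply, hy3] at hy1
  exact lt_irrefl _ hy1

end generic


section lattice
variable (L : PeriodPair)

/-- Sum over the lattice of `1/((z-l)^2 (z-a-l))`, omitting `l = l₀`. -/
def gEx (a l₀ z : ℂ) : ℂ :=
  ∑' l : L.lattice, if (l : ℂ) = l₀ then 0 else 1 / ((z - l) ^ 2 * (z - a - l))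

lemma gEx_hasSumLocallyUniformly (a l₀ : ℂ) :
    HasSumLocallyUniformly (fun (l : L.lattice) (z : ℂ) ↦
      if (l : ℂ) = l₀ then 0 else 1 / ((z - l) ^ 2 * (z - a - l))) (gEx L a l₀) := by
  refine L.hasSumLocallyUniformly_aux (u := fun _ ↦ (8 * ‖·‖ ^ (-3 : ℝ))) _
    (fun _ _ ↦ (ZLattice.summable_norm_rpow _ _ (by simp; norm_num)).mul_left _) fun r hr ↦
    Filter.eventually_atTop.mpr ⟨2 * (r + ‖a‖), ?_⟩
  rintro _ h s hs l rfl
  have hl0 : 0 < ‖(l : ℂ)‖ := by have := norm_nonneg a; linarith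
  have hcast : ‖l‖ = ‖(l : ℂ)‖ := rfl
  have e3 : ‖(l:ℂ)‖ ^ (-3 : ℝ) = (‖(l:ℂ)‖ ^ 3)⁻¹ := by
    rw [Real.rpow_neg hl0.le]; norm_cast
  rw [hcast, e3]
  split_ifs
  · simp
  have h1 : ‖(l:ℂ)‖ / 2 ≤ ‖s - l‖ := by
    rw [norm_sub_rev]
    have := norm_sub_norm_le (l:ℂ) s
    have := norm_nonneg a
    linarith
  have h2 : ‖(l:ℂ)‖ / 2 ≤ ‖s - a - l‖ := by
    rw [norm_sub_rev]
    have := norm_sub_norm_le (l:ℂ) (s - a)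
    have := norm_sub_le s a
    linarith
  rw [norm_div, norm_mul, norm_pow, norm_one]
  calc 1 / (‖s - l‖ ^ 2 * ‖s - a - l‖) ≤ 1 / ((‖(l:ℂ)‖ / 2) ^ 2 * (‖(l:ℂ)‖ / 2)) := by gcongr
    _ = 8 * (‖(l:ℂ)‖ ^ 3)⁻¹ := by field_simp; norm_num

lemma gEx_analyticAt (a l₀ z : ℂ) (h1 : z ∈ L.lattice → z = l₀) (h2 : z - a ∈ L.lattice → z - a = l₀) :
    AnalyticAt ℂ (gEx L a l₀) z := by
  have ho1 : IsOpen ((L.lattice \ {l₀} : Set ℂ)ᶜ) := L.isOpen_compl_lattice_sdiff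
  have ho : IsOpen (((L.lattice \ {l₀} : Set ℂ)ᶜ) ∩ (fun z => z - a) ⁻¹' ((L.lattice \ {l₀} : Set ℂ)ᶜ)) :=
    ho1.inter (ho1.preimage (by fun_prop))
  have hd : DifferentiableOn ℂ (gEx L a l₀)
      (((L.lattice \ {l₀} : Set ℂ)ᶜ) ∩ (fun z => z - a) ⁻¹' ((L.lattice \ {l₀} : Set ℂ)ᶜ)) := by
    refine (gEx_hasSumLocallyUniformly L a l₀).hasSumLocallyUniformlyOn.differentiableOn
      (.of_forall fun s ↦ .fun_sum fun i hi ↦ ?_) ho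
    split_ifs with hil
    · simp
    · refine .div (by fun_prop) (by fun_prop) fun x hx ↦ ?_
      have e1 : x ≠ i := by rintro rfl; exact hx.1 ⟨i.2, hil⟩
      have e2 : x - a ≠ i := by
        intro h
        have := hx.2
        simp only [Set.mem_preimage, h] at this
        exact this ⟨i.2, hil⟩
      exact mul_ne_zero (pow_ne_zero _ (sub_ne_zero.2 e1)) (sub_ne_zero.2 e2)
  refine hd.analyticAt (ho.mem_nhds ⟨?_, ?_⟩)
  · rintro ⟨h, h'⟩; exact h' (h1 h)
  · rintro ⟨h, h'⟩; exact h' (h2 h)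

lemma gEx_add (a : ℂ) (ha : a ∉ L.lattice) (l₀ : L.lattice) (z : ℂ) :
    gEx L a a z = gEx L a l₀ z + 1 / ((z - l₀) ^ 2 * (z - a - l₀)) := by
  have h1 := (gEx_hasSumLocallyUniformly L a l₀).hasSum (x := z)
  have h2 : HasSum (fun l : L.lattice => if l = l₀ then 1 / ((z - l₀) ^ 2 * (z - a - l₀)) else 0)
    (1 / ((z - l₀) ^ 2 * (z - a - l₀))) := hasSum_ite_eq l₀ _
  have h3 := h1.add h2
  rw [← h3.tsum_eq]
  unfold gEx
  congr 1
  ext l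
  have : (l : ℂ) ≠ a := fun h => ha (h ▸ l.2)
  rw [if_neg this]
  by_cases hl : l = l₀
  · subst hl; simp
  · have : (l : ℂ) ≠ l₀ := fun h => hl (Subtype.ext h)
    simp [hl]

lemma gEx_periodic (a : ℂ) (ha : a ∉ L.lattice) (γ : L.lattice) (z : ℂ) :
    gEx L a a (z + γ) = gEx L a a z := by
  unfold gEx
  rw [← (Equiv.addRight γ).tsum_eq]
  congr 1
  ext l
  have h1 : (l : ℂ) ≠ a := fun h => ha (h ▸ l.2)
  have h2 : ((Equiv.addRight γ l : L.lattice) : ℂ) ≠ a := fun h => ha (h ▸ (l + γ).2)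
  have h3 : ((Equiv.addRight γ l : L.lattice) : ℂ) = l + γ := rfl
  rw [if_neg h1, if_neg h2, h3]
  congr 2 <;> ring

/-- Elliptic function with simple poles exactly at `L` and `a + L`. -/
def ellF (a z : ℂ) : ℂ := a * gEx L a a z + L.weierstrassP z

lemma ellF_local (a : ℂ) (ha : a ∉ L.lattice) (z₀ : ℂ) :
    ∃ h k : ℂ → ℂ, AnalyticAt ℂ h z₀ ∧ AnalyticAt ℂ k z₀ ∧
      (∀ᶠ z in 𝓝[≠] z₀, ellF L a z = h z + k z / (z - z₀)) ∧
      ((z₀ ∉ L.lattice ∧ z₀ - a ∉ L.lattice) → k = 0) ∧ (z₀ = a → k z₀ ≠ 0) := by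
  have ha0 : a ≠ 0 := by rintro rfl; exact ha (zero_mem _)
  by_cases hz : z₀ ∈ L.lattice
  · have hza : z₀ - a ∉ L.lattice := fun h => ha (by simpa using sub_mem hz h)
    refine ⟨fun z => a * gEx L a z₀ z + L.weierstrassPExcept z₀ z - 1 / z₀ ^ 2,
      fun z => 1 / (z - a - z₀), ?_, ?_, ?_, ?_, ?_⟩
    · exact ((analyticAt_const.mul (gEx_analyticAt L a z₀ z₀ (fun _ => rfl) (fun h => absurd h hza))).add
        (L.analyticAt_weierstrassPExcept z₀)).sub analyticAt_const
    · exact analyticAt_const.div (by fun_prop) (by simpa using ha0)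
    · have hev : ∀ᶠ z in 𝓝 z₀, z - a - z₀ ≠ 0 := by
        refine ContinuousAt.eventually_ne (by fun_prop) (by simpa using ha0)
      filter_upwards [self_mem_nhdsWithin, hev.filter_mono nhdsWithin_le_nhds] with z hz1 hz2
      have hz3 : z - z₀ ≠ 0 := sub_ne_zero.2 hz1
      unfold ellF
      rw [gEx_add L a ha ⟨z₀, hz⟩, ← L.weierstrassPExcept_add ⟨z₀, hz⟩]
      simp only
      have : a * (1 / ((z - z₀) ^ 2 * (z - a - z₀))) + 1 / (z - z₀)^2 = 1 / (z - a - z₀) / (z - z₀) := by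
        field_simp
        ring
      linear_combination this
    · exact fun h => absurd hz h.1
    · rintro rfl; exact absurd hz ha
  · by_cases hza : z₀ - a ∈ L.lattice
    · refine ⟨fun z => a * gEx L a (z₀ - a) z + L.weierstrassP z,
        fun z => a / (z - (z₀ - a)) ^ 2, ?_, ?_, ?_, ?_, ?_⟩
      · exact (analyticAt_const.mul (gEx_analyticAt L a (z₀ - a) z₀ (fun h => absurd h hz) (fun _ => rfl))).add
          (L.analyticOnNhd_weierstrassP z₀ hz)
      · exact analyticAt_const.div (by fun_prop) (by simpa using ha0)
      · refine Eventually.of_forall fun z => ?_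
        unfold ellF
        rw [gEx_add L a ha ⟨z₀ - a, hza⟩]
        simp only
        rw [show z - a - (z₀ - a) = z - z₀ by ring, div_div]
        ring
      · exact fun h => absurd hza h.2
      · intro h
        simpa using ha0
    · refine ⟨ellF L a, 0, ?_, analyticAt_const, by simp, fun _ => rfl, ?_⟩
      · refine (analyticAt_const.mul (gEx_analyticAt L a a z₀ (fun h => absurd h hz)
          (fun h => absurd h hza))).add (L.analyticOnNhd_weierstrassP z₀ hz)
      · rintro rfl; simp at hza

lemma ellF_meromorphicAt (a : ℂ) (ha : a ∉ L.lattice) (z₀ : ℂ) : MeromorphicAt (ellF L a) z₀ := by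
  obtain ⟨h, k, hh, hk, he, -, -⟩ := ellF_local L a ha z₀
  have h1 : MeromorphicAt (fun z => h z + k z / (z - z₀)) z₀ :=
    hh.meromorphicAt.add (hk.meromorphicAt.div (by fun_prop))
  exact h1.congr (he.mono fun z hz => hz.symm)

lemma ellF_order (a : ℂ) (ha : a ∉ L.lattice) : meromorphicOrderAt (ellF L a) a < 0 := by
  obtain ⟨h, k, hh, hk, he, -, hne⟩ := ellF_local L a ha a
  have : meromorphicOrderAt (ellF L a) a = ((-1 : ℤ) : WithTop ℤ) := by
    rw [meromorphicOrderAt_eq_int_iff (ellF_meromorphicAt L a ha a)]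
    refine ⟨fun z => (z - a) * h z + k z, by fun_prop, by simpa using hne rfl, ?_⟩
    filter_upwards [he, self_mem_nhdsWithin] with z hz hza
    have : z - a ≠ 0 := sub_ne_zero.2 hza
    rw [hz]
    simp only [zpow_neg, zpow_one, smul_eq_mul]
    field_simp
  rw [this]
  exact_mod_cast (by norm_num : (-1:ℤ) < 0)

lemma ellF_periodic (a : ℂ) (ha : a ∉ L.lattice) (γ : ℂ) (hγ : γ ∈ L.lattice) (z : ℂ) :
    ellF L a (z + γ) = ellF L a z := by
  unfold ellF
  have h1 := gEx_periodic L a ha ⟨γ, hγ⟩ z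
  have h2 := L.weierstrassP_add_coe z ⟨γ, hγ⟩
  simp only at h1 h2
  rw [h1, h2]

end lattice

lemma AnalyticAt.contDiffAt_real {h : ℂ → ℂ} {z : ℂ} (hh : AnalyticAt ℂ h z) :
    ContDiffAt ℝ (⊤ : ℕ∞) h z := hh.contDiffAt.restrict_scalars ℝ

section zeros
variable {E : Type*} [NormedAddCommGroup E] [NormedSpace ℂ E] [CompleteSpace E]

lemma two_zeros (L : PeriodPair) (χ : ℂ → E →L[ℂ] E) (A : ℂ → E →L[ℂ] E)
    (hA : ContDiff ℝ (⊤ : ℕ∞) A)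
    (u : ℂ → E) (hu : ContDiff ℝ (⊤ : ℕ∞) u)
    (hbc : ∀ γ ∈ (L.lattice : Set ℂ), ∀ z, u (z + γ) = χ γ (u z))
    (heq : ∀ z, dbarV u z = A z (u z)) (hne : ∃ z, u z ≠ 0)
    (hker : ∀ v : ℂ → E, ContDiff ℝ (⊤ : ℕ∞) v →
      (∀ γ ∈ (L.lattice : Set ℂ), ∀ z, v (z + γ) = χ γ (v z)) →
      (∀ z, dbarV v z = A z (v z)) → ∃ c : ℂ, v = c • u)
    (p q : ℂ) (hpq : q - p ∉ L.lattice) (hp : u p = 0) (hq : u q = 0) : False := by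
  have hsh : ∀ z : ℂ, Tendsto (fun y => y - p) (𝓝[≠] z) (𝓝[≠] (z - p)) := by
    intro z
    refine tendsto_nhdsWithin_iff.2 ⟨?_, ?_⟩
    · exact (by fun_prop : Continuous fun y : ℂ => y - p).continuousAt.tendsto.mono_left nhdsWithin_le_nhds
    · filter_upwards [self_mem_nhdsWithin] with y hy
      simpa using hy
  -- local form of the translated function
  have hloc : ∀ z₀, ∃ h k : ℂ → ℂ, AnalyticAt ℂ h z₀ ∧ AnalyticAt ℂ k z₀ ∧
      (∀ᶠ z in 𝓝[≠] z₀, ellF L (q - p) (z - p) = h z + k z / (z - z₀)) ∧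
      ((z₀ - p ∉ L.lattice ∧ z₀ - q ∉ L.lattice) → k = 0) ∧ (z₀ = q → k z₀ ≠ 0) := by
    intro z₀
    obtain ⟨h, k, hh, hk, he, h0, hn⟩ := ellF_local L (q - p) hpq (z₀ - p)
    have hid : AnalyticAt ℂ (fun z : ℂ => z - p) z₀ := by fun_prop
    refine ⟨fun z => h (z - p), fun z => k (z - p), AnalyticAt.fun_comp (f := fun z : ℂ => z - p) hh hid,
      AnalyticAt.fun_comp (f := fun z : ℂ => z - p) hk hid, ?_, ?_, ?_⟩
    · filter_upwards [(hsh z₀).eventually he] with z hz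
      rw [hz]; congr 2; ring
    · rintro ⟨h1, h2⟩
      have := h0 ⟨h1, by rwa [show z₀ - p - (q - p) = z₀ - q by ring]⟩
      ext z; simp [this]
    · rintro rfl; exact hn rfl
  have hmer : ∀ z₀, MeromorphicAt (fun z => ellF L (q - p) (z - p)) z₀ := by
    intro z₀
    obtain ⟨h, k, hh, hk, he, -, -⟩ := hloc z₀
    have h1 : MeromorphicAt (fun z => h z + k z / (z - z₀)) z₀ :=
      hh.meromorphicAt.add (hk.meromorphicAt.div (by fun_prop))
    exact h1.congr (he.mono fun z hz => hz.symm)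
  refine engine (L.lattice : Set ℂ) χ A hA u hu hbc heq hne hker
    (fun z => ellF L (q - p) (z - p)) hmer ?_ ?_ q ?_
  · intro γ hγ z
    rw [show z + γ - p = z - p + γ by ring, ellF_periodic L _ hpq γ hγ]
  · intro z₀
    obtain ⟨h, k, hh, hk, he, h0, -⟩ := hloc z₀
    by_cases hz : u z₀ = 0
    · obtain ⟨W, hW, hWu, -⟩ := division u hu z₀ hz A hA heq
      refine ⟨fun z => h z • u z + k z • W z, ?_, ?_⟩
      · exact (hh.contDiffAt_real.smul hu.contDiffAt).add (hk.contDiffAt_real.smul hW.contDiffAt)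
      · filter_upwards [he, self_mem_nhdsWithin] with z hz1 hz2
        have : z - z₀ ≠ 0 := sub_ne_zero.2 hz2
        rw [hz1, add_smul, hWu z, smul_smul (k z / (z - z₀)), div_mul_cancel₀ _ this]
    · have hk0 : k = 0 := by
        refine h0 ⟨fun hm => hz ?_, fun hm => hz ?_⟩
        · have := hbc _ hm p
          rwa [hp, map_zero, add_sub_cancel] at this
        · have := hbc _ hm q
          rwa [hq, map_zero, add_sub_cancel] at this
      refine ⟨fun z => h z • u z, hh.contDiffAt_real.smul hu.contDiffAt, ?_⟩
      filter_upwards [he] with z hz1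
      rw [hz1, hk0]; simp
  · obtain ⟨h, k, hh, hk, he, -, hn⟩ := hloc q
    have : meromorphicOrderAt (fun z => ellF L (q - p) (z - p)) q = ((-1 : ℤ) : WithTop ℤ) := by
      rw [meromorphicOrderAt_eq_int_iff (hmer q)]
      refine ⟨fun z => (z - q) * h z + k z, by fun_prop, by simpa using hn rfl, ?_⟩
      filter_upwards [he, self_mem_nhdsWithin] with z hz hza
      have : z - q ≠ 0 := sub_ne_zero.2 hza
      rw [hz]
      simp only [zpow_neg, zpow_one, smul_eq_mul]
      field_simp
    rw [this]
    exact_mod_cast (by norm_num : (-1:ℤ) < 0)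

lemma double_zero (L : PeriodPair) (χ : ℂ → E →L[ℂ] E) (A : ℂ → E →L[ℂ] E)
    (hA : ContDiff ℝ (⊤ : ℕ∞) A)
    (u : ℂ → E) (hu : ContDiff ℝ (⊤ : ℕ∞) u)
    (hbc : ∀ γ ∈ (L.lattice : Set ℂ), ∀ z, u (z + γ) = χ γ (u z))
    (heq : ∀ z, dbarV u z = A z (u z)) (hne : ∃ z, u z ≠ 0)
    (hker : ∀ v : ℂ → E, ContDiff ℝ (⊤ : ℕ∞) v →
      (∀ γ ∈ (L.lattice : Set ℂ), ∀ z, v (z + γ) = χ γ (v z)) →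
      (∀ z, dbarV v z = A z (v z)) → ∃ c : ℂ, v = c • u)
    (W : ℂ → E) (hW : ContDiff ℝ (⊤ : ℕ∞) W) (huW : ∀ z, u z = z • W z)
    (hWeq : ∀ z, dbarV W z = A z (W z)) (hW0 : W 0 = 0) : False := by
  obtain ⟨W₂, hW₂, hWW, -⟩ := division W hW 0 hW0 A hA hWeq
  refine engine (L.lattice : Set ℂ) χ A hA u hu hbc heq hne hker
    L.weierstrassP (fun z => L.meromorphic_weierstrassP z) ?_ ?_ 0 ?_
  · intro γ hγ z
    exact L.weierstrassP_add_coe z ⟨γ, hγ⟩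
  · intro z₀
    by_cases hz : z₀ ∈ L.lattice
    · refine ⟨fun z => (L.weierstrassPExcept z₀ z - 1 / z₀ ^ 2) • u z + χ z₀ (W₂ (z - z₀)), ?_, ?_⟩
      · refine ContDiffAt.add ?_ ?_
        · exact (((L.analyticAt_weierstrassPExcept z₀).sub analyticAt_const).contDiffAt_real).smul hu.contDiffAt
        · exact (((χ z₀).restrictScalars ℝ).contDiff.comp
            (hW₂.comp (contDiff_id.sub contDiff_const))).contDiffAt
      · filter_upwards [self_mem_nhdsWithin] with z hz2
        have h1 : (z - z₀) ^ 2 ≠ 0 := pow_ne_zero _ (sub_ne_zero.2 hz2)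
        have h2 : u z = (z - z₀) ^ 2 • χ z₀ (W₂ (z - z₀)) := by
          have := hbc z₀ hz (z - z₀)
          rw [sub_add_cancel, huW (z - z₀), hWW, sub_zero, smul_smul, map_smul] at this
          rw [this, sq]
        have h3 : L.weierstrassP z = (L.weierstrassPExcept z₀ z - 1 / z₀ ^ 2) + 1 / (z - z₀) ^ 2 := by
          rw [← L.weierstrassPExcept_add ⟨z₀, hz⟩]
          simp only
          ring
        rw [h3, add_smul]
        congr 1
        rw [h2, smul_smul, one_div, inv_mul_cancel₀ h1, one_smul]
    · refine ⟨fun z => L.weierstrassP z • u z, ?_, EventuallyEq.rfl⟩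
      exact (L.analyticOnNhd_weierstrassP z₀ hz).contDiffAt_real.smul hu.contDiffAt
  · rw [L.order_weierstrassP 0 (zero_mem _), show (-2 : WithTop ℤ) = ((-2 : ℤ) : WithTop ℤ) by norm_num]
    exact_mod_cast (by norm_num : (-2:ℤ) < 0)

end zeros


lemma om_re : ω.re = -1/2 := by
  have : (2 * Real.pi * Complex.I / 3 : ℂ) = ((Real.pi - Real.pi / 3 : ℝ) : ℂ) * I := by push_cast; ring
  rw [ω, this, Complex.exp_ofReal_mul_I_re, Real.cos_pi_sub, Real.cos_pi_div_three]; norm_num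

lemma om_im : ω.im = √3/2 := by
  have : (2 * Real.pi * Complex.I / 3 : ℂ) = ((Real.pi - Real.pi / 3 : ℝ) : ℂ) * I := by push_cast; ring
  rw [ω, this, Complex.exp_ofReal_mul_I_im, Real.sin_pi_sub, Real.sin_pi_div_three]

lemma om_im_ne : ω.im ≠ 0 := by rw [om_im]; positivity

lemma om_sq : ω ^ 2 = -1 - ω := by
  have h3 : √3 * √3 = 3 := Real.mul_self_sqrt (by norm_num)
  apply Complex.ext
  · simp only [sq, Complex.mul_re, Complex.sub_re, Complex.neg_re, Complex.one_re, om_re, om_im]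
    linear_combination (-1/4 : ℝ) * h3
  · simp only [sq, Complex.mul_im, Complex.sub_im, Complex.neg_im, Complex.one_im, om_re, om_im]
    ring

lemma om_conj : conj ω = -1 - ω := by
  apply Complex.ext
  · simp [om_re]; norm_num
  · simp

lemma om_cube : ω ^ 3 = 1 := by
  linear_combination (ω - 1) * om_sq

lemma om_ne_one : ω ≠ 1 := by
  intro h
  have := congrArg Complex.im h
  exact om_im_ne (by simpa using this)

lemma om_ne_zero : ω ≠ 0 := Complex.exp_ne_zero _

/-- The period pair of the lattice `Lam`. -/
def Lpair : PeriodPair where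
  ω₁ := 1
  ω₂ := ω
  indep := by
    rw [LinearIndependent.pair_iff]
    intro s t h
    have h1 := congrArg Complex.im h
    have h2 := congrArg Complex.re h
    simp at h1 h2
    have ht : t = 0 := by rcases h1 with h1 | h1; exacts [h1, absurd h1 om_im_ne]
    subst ht
    simpa using h2

lemma Lpair_lattice : (Lpair.lattice : Set ℂ) = Lam := by
  ext z
  simp only [SetLike.mem_coe, PeriodPair.mem_lattice, Lam, Set.mem_setOf_eq, Lpair, mul_one]
  constructor
  · rintro ⟨m, n, h⟩; exact ⟨m, n, h.symm⟩
  · rintro ⟨m, n, h⟩; exact ⟨m, n, h.symm⟩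

lemma pairing_K (γ : ℂ) : pairing γ Kpt = γ.re * (4 * Real.pi / 3) := by
  have : Kpt = ((4 * Real.pi / 3 : ℝ) : ℂ) := by unfold Kpt; push_cast; ring
  rw [pairing, this, Complex.conj_ofReal, Complex.re_mul_ofReal]

/-- Boundary-condition multiplier. -/
def chi (γ : ℂ) : ℂ × ℂ →L[ℂ] ℂ × ℂ :=
  (Complex.exp (-Complex.I * (pairing γ Kpt : ℂ)) • ContinuousLinearMap.fst ℂ ℂ ℂ).prod
    (Complex.exp (Complex.I * (pairing γ Kpt : ℂ)) • ContinuousLinearMap.snd ℂ ℂ ℂ)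

lemma BC_iff (u : ℂ → ℂ × ℂ) : BC u ↔ ∀ γ ∈ (Lpair.lattice : Set ℂ), ∀ z, u (z + γ) = chi γ (u z) := by
  rw [Lpair_lattice]
  rfl

/-- Matrix of zeroth order terms. -/
def Amat (U : ℂ → ℂ) (α : ℂ) (z : ℂ) : ℂ × ℂ →L[ℂ] ℂ × ℂ :=
  (-I * α * U z) • ((ContinuousLinearMap.inl ℂ ℂ ℂ).comp (ContinuousLinearMap.snd ℂ ℂ ℂ)) +
  (-I * α * U (-z)) • ((ContinuousLinearMap.inr ℂ ℂ ℂ).comp (ContinuousLinearMap.fst ℂ ℂ ℂ))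

lemma Amat_contDiff (U : ℂ → ℂ) (α : ℂ) (hU : ContDiff ℝ (⊤ : ℕ∞) U) :
    ContDiff ℝ (⊤ : ℕ∞) (Amat U α) := by
  unfold Amat
  exact ((contDiff_const.mul hU).smul contDiff_const).add
    ((contDiff_const.mul (hU.comp contDiff_neg)).smul contDiff_const)

lemma Dop_iff (U : ℂ → ℂ) (α : ℂ) (u : ℂ → ℂ × ℂ) (z : ℂ) (hu : DifferentiableAt ℝ u z) :
    Dop U α u z = 0 ↔ dbarV u z = Amat U α z (u z) := by
  have h1 : fderiv ℝ (fun w => (u w).1) z = (ContinuousLinearMap.fst ℝ ℂ ℂ).comp (fderiv ℝ u z) :=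
    hu.hasFDerivAt.fst.fderiv
  have h2 : fderiv ℝ (fun w => (u w).2) z = (ContinuousLinearMap.snd ℝ ℂ ℂ).comp (fderiv ℝ u z) :=
    hu.hasFDerivAt.snd.fderiv
  have hI : I * I = -1 := Complex.I_mul_I
  unfold Dop twoDbar dbarV Amat
  rw [h1, h2, Prod.ext_iff, Prod.ext_iff]
  simp
  refine and_congr ⟨fun h => ?_, fun h => ?_⟩ ⟨fun h => ?_, fun h => ?_⟩
  · linear_combination I * h + ((fderiv ℝ u z 1).1 + I * (fderiv ℝ u z I).1) * hI
  · linear_combination (-I) * h + (α * U z * (u z).2) * hI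
  · linear_combination I * h + ((fderiv ℝ u z 1).2 + I * (fderiv ℝ u z I).2) * hI
  · linear_combination (-I) * h + (α * U (-z) * (u z).1) * hI

lemma rot_dbar {E : Type*} [NormedAddCommGroup E] [NormedSpace ℂ E] (u : ℂ → E) (hu : Differentiable ℝ u)
    (c z : ℂ) : dbarV (fun z => u (c * z)) z = conj c • dbarV u (c * z) := by
  have h1 : HasFDerivAt (fun z : ℂ => c * z) (c • ContinuousLinearMap.id ℝ ℂ) z :=
    (hasFDerivAt_id z).const_mul c
  have h2 := ((hu (c * z)).hasFDerivAt.comp z h1).fderiv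
  have h3 : fderiv ℝ (fun z => u (c * z)) z = (fderiv ℝ u (c * z)).comp (c • ContinuousLinearMap.id ℝ ℂ) := h2
  unfold dbarV
  rw [h3]
  set T := fderiv ℝ u (c * z)
  have e1 : c = c.re • (1:ℂ) + c.im • I := by simp [Complex.re_add_im]
  have e2 : c * I = (-c.im) • (1:ℂ) + c.re • I := by
    apply Complex.ext <;> simp
  have hT1 : T c = (c.re : ℂ) • T 1 + (c.im : ℂ) • T I := by
    conv_lhs => rw [e1]
    rw [map_add, map_smul, map_smul, Complex.coe_smul, Complex.coe_smul]
  have hT2 : T (c * I) = (-c.im : ℂ) • T 1 + (c.re : ℂ) • T I := by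
    rw [e2, map_add, map_smul, map_smul, ← Complex.ofReal_neg, Complex.coe_smul, Complex.coe_smul]
  have hzc : conj c = (c.re : ℂ) - c.im * I := by apply Complex.ext <;> simp
  have hI : I * I = -1 := Complex.I_mul_I
  simp only [ContinuousLinearMap.comp_apply, ContinuousLinearMap.smul_apply, ContinuousLinearMap.id_apply,
    smul_eq_mul, mul_one]
  rw [hT1, hT2, hzc]
  match_scalars
  · ring
  · linear_combination (c.im : ℂ) * hI

lemma exp_pairing_om (γ : ℂ) (hγ : γ ∈ Lam) :
    Complex.exp (I * (pairing (ω * γ) Kpt : ℂ)) = Complex.exp (I * (pairing γ Kpt : ℂ)) ∧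
    Complex.exp (-I * (pairing (ω * γ) Kpt : ℂ)) = Complex.exp (-I * (pairing γ Kpt : ℂ)) := by
  obtain ⟨m, n, rfl⟩ := hγ
  have h : pairing (ω * ((m:ℂ) + n * ω)) Kpt = pairing ((m:ℂ) + n * ω) Kpt - m * (2 * Real.pi) := by
    rw [show ω * ((m:ℂ) + n * ω) = -n + (m - n) * ω by linear_combination (n:ℂ) * om_sq,
      pairing_K, pairing_K]
    simp [om_re]
    ring
  rw [h]
  constructor
  · rw [Complex.exp_eq_exp_iff_exists_int]
    exact ⟨-m, by push_cast; ring⟩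
  · rw [Complex.exp_eq_exp_iff_exists_int]
    exact ⟨m, by push_cast; ring⟩

lemma om_mul_mem (γ : ℂ) (hγ : γ ∈ Lam) : ω * γ ∈ Lam := by
  obtain ⟨m, n, rfl⟩ := hγ
  exact ⟨-n, m - n, by push_cast; linear_combination (n:ℂ) * om_sq⟩

lemma third_notMem (k : ℤ) (hk : ¬ (3:ℤ) ∣ k) : (k : ℂ) * ((1 + 2 * ω) / 3) ∉ Lam := by
  rintro ⟨m, n, h⟩
  have h1 := congrArg Complex.re h
  have h2 := congrArg Complex.im h
  have e : (k : ℂ) * ((1 + 2 * ω) / 3) = ((k / 3 : ℝ) : ℂ) * 1 + ((2 * k / 3 : ℝ) : ℂ) * ω := by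
    push_cast; ring
  rw [e] at h1 h2
  simp at h1 h2
  have h3 : (2 * k / 3 : ℝ) = n := h2.resolve_right om_im_ne
  rw [h3] at h1
  have h4 : (k : ℝ) / 3 = m := by linarith
  apply hk
  refine ⟨m, ?_⟩
  have : (k : ℝ) = 3 * m := by linarith
  exact_mod_cast this

/-- values of the multiplier at `1 + ω` and `-(1 + ω)`. -/
lemma pairing_one_add : pairing (1 + ω) Kpt = 2 * Real.pi / 3 := by
  rw [pairing_K]; simp [om_re]; ring

lemma exp_neg_ne : Complex.exp (-(2 * Real.pi * I / 3)) ≠ 1 := by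
  rw [Complex.exp_neg]
  intro h
  exact om_ne_one (inv_eq_one.1 h)

lemma chi_fix_one (v : ℂ × ℂ) (h : chi (1 + ω) v = v) : v = 0 := by
  have h1 := congrArg Prod.fst h
  have h2 := congrArg Prod.snd h
  simp only [chi, pairing_one_add] at h1 h2
  simp at h1 h2
  rw [show (-(I * (2 * Real.pi / 3)) : ℂ) = -(2 * Real.pi * I / 3) by ring] at h1
  rw [show (I * (2 * Real.pi / 3) : ℂ) = (2 * Real.pi * I / 3) by ring] at h2
  have h1' : v.1 = 0 := by
    by_contra hv
    exact exp_neg_ne (mul_right_cancel₀ hv (h1.trans (one_mul _).symm))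
  have h2' : v.2 = 0 := by
    by_contra hv
    exact om_ne_one (mul_right_cancel₀ hv (h2.trans (one_mul _).symm))
  exact Prod.ext h1' h2'

lemma chi_fix_neg (v : ℂ × ℂ) (h : chi (-(1 + ω)) v = v) : v = 0 := by
  have hp : pairing (-(1 + ω)) Kpt = -(2 * Real.pi / 3) := by
    rw [pairing_K]; simp [om_re]; ring
  have h1 := congrArg Prod.fst h
  have h2 := congrArg Prod.snd h
  simp only [chi, hp] at h1 h2
  simp at h1 h2
  rw [show (I * (2 * Real.pi / 3) : ℂ) = (2 * Real.pi * I / 3) by ring] at h1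
  rw [show (-(I * (2 * Real.pi / 3)) : ℂ) = -(2 * Real.pi * I / 3) by ring] at h2
  have h1' : v.1 = 0 := by
    by_contra hv
    exact om_ne_one (mul_right_cancel₀ hv (h1.trans (one_mul _).symm))
  have h2' : v.2 = 0 := by
    by_contra hv
    exact exp_neg_ne (mul_right_cancel₀ hv (h2.trans (one_mul _).symm))
  exact Prod.ext h1' h2'

/-- if the kernel of D(α) on L²₀ is one-dimensional, spanned by u₀, then
u₀ is rotation-equivariant, vanishes (simply) exactly on the lattice Λ. -/
theorem stmt14 (U : ℂ → ℂ) (hUpot : IsPotential U) (α : ℂ)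
    (u₀ : ℂ → ℂ × ℂ) (hu₀ : ContDiff ℝ (⊤ : ℕ∞) u₀) (hu₀bc : BC u₀)
    (hu₀eq : ∀ z : ℂ, Dop U α u₀ z = 0) (hu₀ne : ∃ z, u₀ z ≠ 0)
    (hker : ∀ u : ℂ → ℂ × ℂ, ContDiff ℝ (⊤ : ℕ∞) u → BC u →
      (∀ z : ℂ, Dop U α u z = 0) → ∃ c : ℂ, u = c • u₀) :
    (∀ z : ℂ, u₀ (ω * z) = ω • u₀ z) ∧ u₀ 0 = 0 ∧
    (∃ w : ℂ → ℂ × ℂ, ContDiff ℝ (⊤ : ℕ∞) w ∧ (∀ z : ℂ, u₀ z = z • w z) ∧ w 0 ≠ 0) ∧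
    (∀ z : ℂ, z ∉ Lam → u₀ z ≠ 0) := by
  obtain ⟨hU, -, hUrot, -⟩ := hUpot
  have hA := Amat_contDiff U α hU
  have hbc := (BC_iff u₀).1 hu₀bc
  have hd : Differentiable ℝ u₀ := hu₀.differentiable (by simp)
  have heq : ∀ z, dbarV u₀ z = Amat U α z (u₀ z) := fun z => (Dop_iff U α u₀ z (hd z)).1 (hu₀eq z)
  have hker' : ∀ v : ℂ → ℂ × ℂ, ContDiff ℝ (⊤ : ℕ∞) v →
      (∀ γ ∈ (Lpair.lattice : Set ℂ), ∀ z, v (z + γ) = chi γ (v z)) →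
      (∀ z, dbarV v z = Amat U α z (v z)) → ∃ c : ℂ, v = c • u₀ := fun v hv hvb hve =>
    hker v hv ((BC_iff v).2 hvb) fun z => (Dop_iff U α v z (hv.differentiable (by simp) z)).2 (hve z)
  have htwo : ∀ p q : ℂ, q - p ∉ Lam → u₀ p = 0 → u₀ q = 0 → False := by
    intro p q hpq
    exact two_zeros Lpair chi (Amat U α) hA u₀ hu₀ hbc heq hu₀ne hker' p q
      (by rw [← Lpair_lattice] at hpq; exact hpq)
  -- rotation
  obtain ⟨c, hc⟩ : ∃ c : ℂ, (fun z => u₀ (ω * z)) = c • u₀ := by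
    have hs : ContDiff ℝ (⊤ : ℕ∞) (fun z => u₀ (ω * z)) := hu₀.comp (contDiff_const.mul contDiff_id)
    refine hker' _ hs ?_ ?_
    · intro γ hγ z
      have hγ' : γ ∈ Lam := by rw [← Lpair_lattice]; exact hγ
      have h1 := hu₀bc (ω * γ) (om_mul_mem γ hγ') (ω * z)
      rw [(exp_pairing_om γ hγ').1, (exp_pairing_om γ hγ').2] at h1
      rw [mul_add, h1]
      rfl
    · intro z
      rw [rot_dbar u₀ hd, heq]
      have hcc : conj ω * ω = 1 := by rw [om_conj]; linear_combination -om_sq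
      have hm : U (-(ω * z)) = ω * U (-z) := by rw [← hUrot]; congr 1; ring
      unfold Amat
      rw [hUrot, hm]
      apply Prod.ext
      · simp
        linear_combination (I * α * U z * (u₀ (ω * z)).2) * hcc
      · simp
        linear_combination (I * α * U (-z) * (u₀ (ω * z)).1) * hcc
  have hrot : ∀ z, u₀ (ω * z) = c • u₀ z := fun z => congrFun hc z
  have h0 : u₀ 0 = 0 := by
    by_contra hn
    have hc1 : c = 1 := by
      have h := hrot 0
      rw [mul_zero, ← sub_eq_zero] at h
      nth_rewrite 1 [← one_smul ℂ (u₀ 0)] at h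
      rw [← sub_smul, smul_eq_zero] at h
      exact (sub_eq_zero.1 (h.resolve_right hn)).symm
    have hmem : (1 + ω) ∈ Lam := ⟨1, 1, by push_cast; ring⟩
    have hmem' : -(1 + ω) ∈ Lam := ⟨-1, -1, by push_cast; ring⟩
    rw [← Lpair_lattice] at hmem hmem'
    have z1 : u₀ ((1 + 2 * ω) / 3) = 0 := by
      apply chi_fix_neg
      rw [← hbc _ hmem']
      have h := hrot ((1 + 2 * ω) / 3)
      rw [hc1, one_smul] at h
      rw [← h]
      congr 1
      linear_combination (-2/3 : ℂ) * om_sq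
    have z2 : u₀ (-((1 + 2 * ω) / 3)) = 0 := by
      apply chi_fix_one
      rw [← hbc _ hmem]
      have h := hrot (-((1 + 2 * ω) / 3))
      rw [hc1, one_smul] at h
      rw [← h]
      congr 1
      linear_combination (2/3 : ℂ) * om_sq
    refine htwo _ _ ?_ z2 z1
    have := third_notMem 2 (by norm_num)
    convert this using 1
    push_cast; ring
  obtain ⟨W, hW, huW, hWeq⟩ := division u₀ hu₀ 0 h0 (Amat U α) hA heq
  simp only [sub_zero] at huW
  have hW0 : W 0 ≠ 0 := fun h =>
    double_zero Lpair chi (Amat U α) hA u₀ hu₀ hbc heq hu₀ne hker' W hW huW hWeq h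
  have hcω : c = ω := by
    have hWc := hW.continuous
    have h : ω • W (ω * 0) = c • W 0 := by
      refine eq_of_punctured (u := fun z => ω • W (ω * z)) (v := fun z => c • W z) (by fun_prop) (by fun_prop) ?_
      filter_upwards [self_mem_nhdsWithin] with z hz
      have h1 := hrot z
      rw [huW, huW z, mul_comm ω z, mul_smul, smul_comm c z] at h1
      have := smul_right_injective (ℂ × ℂ) (show z ≠ 0 from hz) h1
      rw [mul_comm ω z]; exact this
    rw [mul_zero, ← sub_eq_zero, ← sub_smul, smul_eq_zero] at h
    exact (sub_eq_zero.1 (h.resolve_right hW0)).symm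
  refine ⟨fun z => by rw [hrot, hcω], h0, ⟨W, hW, huW, hW0⟩, fun z hz hz0 => ?_⟩
  exact htwo 0 z (by simpa using hz) h0 hz0
end
end
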